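/- Let d ≥ 3 and let K ⊂ ℤ^d be a fixed finite set of nonzero directions. There exists ρ > 0 such that for every λ₁ ∈ ℕ and μ ∈ ℕ with μ ≥ ρ⁻¹ and every k ∈ K there is a smooth function Φ^k_{μ,λ₁} ∈ C^∞(T^d;ℝ) with the following properties: (1) ⨍_{T^d}(Φ^k_{μ,λ₁})² = 1; (2) for all i ≥ 0 and r ∈ [1,∞], |Φ^k_{μ,λ₁}|_{W^{i,r}(T^d)} ≤ M_{i,r,k} λ₁^i μ^{i + d/2 − d/r} for constants M_{i,r,k} independent of μ, λ₁; (3) for all k, k' ∈ K with k ≠ k' and every s ∈ ℝ, the supports of x ↦ Φ^k_{μ,λ₁}(x − sk) and x ↦ Φ^{k'}_{μ,λ₁}(x − sk') are disjoint. -/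

import Mathlib

open MeasureTheory ENNReal NNReal

noncomputable section

namespace NonNewtonian

abbrev Pt (d : ℕ) := Fin d → ℝ

/-- The fundamental domain `[0,1]^d` of the torus `T^d = ℝ^d/ℤ^d`. -/
def box (d : ℕ) : Set (Pt d) := Set.Icc 0 1

/-- Lebesgue measure restricted to the fundamental domain. -/
def μbox (d : ℕ) : Measure (Pt d) := volume.restrict (box d)

/-- `ℤ^d`-periodicity (functions on the torus). -/
def ZPer {d : ℕ} {α : Type*} (f : Pt d → α) : Prop :=
  ∀ (x : Pt d) (m : Fin d → ℤ), f (x + fun i => (m i : ℝ)) = f x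

/-- The `W^{i,r}` norm on the torus. -/
def WNorm (d : ℕ) (i : ℕ) (r : ℝ≥0∞) (g : Pt d → ℝ) : ℝ≥0∞ :=
  ∑ m ∈ Finset.range (i + 1), eLpNorm (fun x => iteratedFDeriv ℝ m g x) r (μbox d)

/-- The real vector in `ℝ^d` associated with a lattice vector `k ∈ ℤ^d`. -/
def latVec {d : ℕ} (k : Fin d → ℤ) : Pt d := fun i => (k i : ℝ)

open Filter Topology

lemma eventually_abs_mul_lt (C : ℝ) {δ : ℝ} (hδ : 0 < δ) :
    ∀ᶠ θ in 𝓝[>] (0 : ℝ), |θ * C| < δ := by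
  have h : Tendsto (fun θ : ℝ => |θ * C|) (𝓝[>] 0) (𝓝 0) := by
    have : Tendsto (fun θ : ℝ => |θ * C|) (𝓝 0) (𝓝 |0 * C|) :=
      (by fun_prop : Continuous fun θ : ℝ => |θ * C|).tendsto 0
    rw [zero_mul, abs_zero] at this
    exact this.mono_left nhdsWithin_le_nhds
  exact h.eventually_lt_const hδ

/-- There is a vector parallel to no nonzero lattice vector. -/
lemma exists_not_parallel_lattice {d : ℕ} (hd : 2 ≤ d) :
    ∃ v : Pt d, ∀ w : Fin d → ℤ, w ≠ 0 →
      ∃ i j, (w j : ℝ) * v i - (w i : ℝ) * v j ≠ 0 := by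
  let i₀ : Fin d := ⟨0, by omega⟩
  let i₁ : Fin d := ⟨1, by omega⟩
  have h01 : i₁ ≠ i₀ := by simp [i₀, i₁]
  refine ⟨fun i => if i = i₀ then 1 else if i = i₁ then √2 else 0, fun w hw => ?_⟩
  by_contra! h
  have h1 := h i₀ i₁
  simp only [if_true, if_neg h01] at h1
  have hw0 : w i₀ = 0 := by
    by_contra h0
    have h2 := (irrational_sqrt_two.intCast_mul h0).ne_int (w i₁)
    apply h2
    linarith
  apply hw
  ext j
  have hj := h i₀ j
  simpa [hw0] using hj

/-- Centres in general position: for distinct directions `k, k'` in `K`, the projection of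
`p k - p k'` along `k - k'` stays off the projected lattice. -/
lemma exists_centers {d : ℕ} (hd : 2 ≤ d) (K : Finset (Fin d → ℤ)) :
    ∃ p : (Fin d → ℤ) → Pt d, (∀ k ∈ K, ∀ i, 1 / 4 < p k i ∧ p k i < 3 / 4) ∧
      ∀ k ∈ K, ∀ k' ∈ K, k ≠ k' → ∃ i j, ∀ z : ℤ,
        (latVec k - latVec k') j * (p k - p k') i
          - (latVec k - latVec k') i * (p k - p k') j ≠ z := by
  obtain ⟨v, hv⟩ := exists_not_parallel_lattice hd
  let e : (Fin d → ℤ) → ℝ := fun k => (Encodable.encode k : ℝ)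
  have he : Function.Injective e := Nat.cast_injective.comp Encodable.encode_injective
  have hbox : ∀ᶠ θ in 𝓝[>] (0 : ℝ), ∀ k ∈ K, ∀ i, |θ * (e k * v i)| < 1 / 4 :=
    (eventually_all_finset K).2 fun k _ => eventually_all.2 fun i =>
      eventually_abs_mul_lt _ (by norm_num)
  have hcross : ∀ᶠ θ in 𝓝[>] (0 : ℝ), ∀ k ∈ K, ∀ k' ∈ K, ∀ i j,
      |θ * ((e k - e k') *
        ((latVec k - latVec k') j * v i - (latVec k - latVec k') i * v j))| < 1 :=
    (eventually_all_finset K).2 fun k _ => (eventually_all_finset K).2 fun k' _ =>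
      eventually_all.2 fun i => eventually_all.2 fun j => eventually_abs_mul_lt _ one_pos
  obtain ⟨θ, hθb, hθc, hθ⟩ := (hbox.and (hcross.and self_mem_nhdsWithin)).exists
  refine ⟨fun k i => 1 / 2 + θ * (e k * v i), fun k hk i => ?_, fun k hk k' hk' hkk => ?_⟩
  · have := abs_lt.1 (hθb k hk i)
    constructor <;> linarith
  · obtain ⟨i, j, hij⟩ := hv (k - k') (sub_ne_zero.2 hkk)
    refine ⟨i, j, fun z hz => ?_⟩
    have hval : θ * ((e k - e k') *
        ((latVec k - latVec k') j * v i - (latVec k - latVec k') i * v j)) = z := by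
      rw [← hz]
      simp only [Pi.sub_apply]
      ring
    have hlt := hθc k hk k' hk' i j
    rw [hval] at hlt
    have hz0 : z = 0 := Int.abs_lt_one_iff.1 (by exact_mod_cast hlt)
    rw [hz0, Int.cast_zero] at hval
    refine mul_ne_zero hθ.ne' (mul_ne_zero (sub_ne_zero.2 (he.ne hkk)) ?_) hval
    simpa [latVec] using hij

lemma exists_pos_le_abs_add_int {c : ℝ} (hc : ∀ z : ℤ, c ≠ z) :
    ∃ η > 0, ∀ z : ℤ, η ≤ |c + z| := by
  refine ⟨|c - round c|, abs_pos.2 (sub_ne_zero.2 (hc _)), fun z => ?_⟩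
  simpa using round_le c (-z)

/-- A line in a lattice direction whose transversal offset is not integral stays away from the
lattice. -/
lemma eventually_le_norm_add_smul_add {d : ℕ} {q w : Pt d} {i j : Fin d} (n : Fin d → ℤ)
    (hw : w = latVec n) (h : ∀ z : ℤ, w j * q i - w i * q j ≠ z) :
    ∀ᶠ ε in 𝓝[>] (0 : ℝ), ∀ (s : ℝ) (m : Fin d → ℤ), ε ≤ ‖q + s • w + latVec m‖ := by
  obtain ⟨η, hη, hle⟩ := exists_pos_le_abs_add_int h
  filter_upwards [eventually_abs_mul_lt (|w i| + |w j|) hη] with ε hε s m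
  by_contra! hlt
  set y := q + s • w + latVec m with hy
  have hkey : w j * q i - w i * q j + ((n j * m i - n i * m j : ℤ) : ℝ)
      = w j * y i - w i * y j := by
    simp only [hy, hw, latVec, Pi.add_apply, Pi.smul_apply, smul_eq_mul]
    push_cast
    ring
  have h1 := hle (n j * m i - n i * m j)
  rw [hkey] at h1
  have hi : |y i| ≤ ε := (norm_le_pi_norm y i).trans hlt.le
  have hj : |y j| ≤ ε := (norm_le_pi_norm y j).trans hlt.le
  have h2 : |w j * y i - w i * y j| ≤ ε * (|w i| + |w j|) := by
    calc |w j * y i - w i * y j| ≤ |w j * y i| + |w i * y j| := abs_sub _ _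
      _ = |w j| * |y i| + |w i| * |y j| := by rw [abs_mul, abs_mul]
      _ ≤ |w j| * ε + |w i| * ε := by gcongr
      _ = _ := by ring
  linarith [le_abs_self (ε * (|w i| + |w j|))]

/-- The `ℤ^d`-periodic function equal to `f` on the cube of side one centred at the origin. -/
def periodize {d : ℕ} (f : Pt d → ℝ) (y : Pt d) : ℝ :=
  f (y - latVec fun i => round (y i))

lemma periodize_add_latVec {d : ℕ} (f : Pt d → ℝ) (y : Pt d) (m : Fin d → ℤ) :
    periodize f (y + latVec m) = periodize f y := by
  unfold periodize
  congr 1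
  ext i
  simp [latVec, round_add_intCast]

lemma eq_zero_of_quarter_le {d : ℕ} {f : Pt d → ℝ}
    (hf : Function.support f ⊆ Metric.ball 0 (1 / 4)) {y : Pt d} {i : Fin d}
    (hy : 1 / 4 ≤ |y i|) : f y = 0 := by
  by_contra h
  have h1 : ‖y‖ < 1 / 4 := by simpa using hf h
  exact absurd ((norm_le_pi_norm y i).trans_lt h1) (not_lt.2 hy)

lemma periodize_eq {d : ℕ} {f : Pt d → ℝ}
    (hf : Function.support f ⊆ Metric.ball 0 (1 / 4)) {y : Pt d} {n : Fin d → ℤ}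
    (hy : ‖y - latVec n‖ < 3 / 4) : periodize f y = f (y - latVec n) := by
  by_cases hn : (fun i => round (y i)) = n
  · rw [periodize, hn]
  · obtain ⟨i, hi⟩ := Function.ne_iff.1 hn
    have h1 : |y i - n i| < 3 / 4 := (norm_le_pi_norm (y - latVec n) i).trans_lt hy
    have h2 := abs_sub_round (y i)
    have h3 : (1 : ℝ) ≤ |(round (y i) : ℝ) - n i| := by
      exact_mod_cast Int.one_le_abs (sub_ne_zero.2 hi)
    have h4 := abs_sub_le (round (y i) : ℝ) (y i) (n i)
    rw [abs_sub_comm (round (y i) : ℝ) (y i)] at h4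
    have h5 : f (y - latVec fun i => round (y i)) = 0 :=
      eq_zero_of_quarter_le hf (i := i) (by simp only [latVec, Pi.sub_apply]; linarith)
    have h6 : f (y - latVec n) = 0 :=
      eq_zero_of_quarter_le hf (i := i) (by simp only [latVec, Pi.sub_apply]; linarith)
    rw [periodize, h5, h6]

lemma periodize_eventuallyEq {d : ℕ} {f : Pt d → ℝ}
    (hf : Function.support f ⊆ Metric.ball 0 (1 / 4)) {y : Pt d} {n : Fin d → ℤ}
    (hy : ‖y - latVec n‖ < 3 / 4) : periodize f =ᶠ[𝓝 y] fun z => f (z - latVec n) := by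
  have ho : IsOpen {z : Pt d | ‖z - latVec n‖ < 3 / 4} :=
    isOpen_lt (by fun_prop) continuous_const
  filter_upwards [ho.mem_nhds hy] with z hz using periodize_eq hf hz

lemma contDiff_periodize {d : ℕ} {f : Pt d → ℝ} {N : ℕ∞}
    (hf : Function.support f ⊆ Metric.ball 0 (1 / 4)) (hc : ContDiff ℝ N f) :
    ContDiff ℝ N (periodize f) := by
  refine contDiff_iff_contDiffAt.2 fun y => ?_
  have hy : ‖y - latVec fun i => round (y i)‖ < 3 / 4 := by
    refine lt_of_le_of_lt ((pi_norm_le_iff_of_nonneg (by norm_num)).2 fun i => ?_)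
      (by norm_num : (1 / 2 : ℝ) < 3 / 4)
    exact abs_sub_round (y i)
  refine ContDiffAt.congr_of_eventuallyEq ?_ (periodize_eventuallyEq hf hy)
  exact (hc.comp (contDiff_id.sub contDiff_const)).contDiffAt

lemma norm_sub_lt_of_mem_box {d : ℕ} {x p : Pt d} (hx : x ∈ box d)
    (hp : ∀ i, 1 / 4 < p i ∧ p i < 3 / 4) : ‖x - p‖ < 3 / 4 := by
  refine (pi_norm_lt_iff (by norm_num)).2 fun i => ?_
  have h0 := hx.1 i
  have h1 := hx.2 i
  simp only [Pi.zero_apply, Pi.one_apply] at h0 h1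
  rw [Real.norm_eq_abs, Pi.sub_apply, abs_lt]
  constructor <;> linarith [(hp i).1, (hp i).2]

lemma latVec_zero {d : ℕ} : latVec (0 : Fin d → ℤ) = 0 := by
  ext i
  simp [latVec]

lemma periodize_sub_eventuallyEq_of_mem_box {d : ℕ} {f : Pt d → ℝ}
    (hf : Function.support f ⊆ Metric.ball 0 (1 / 4)) {x p : Pt d} (hx : x ∈ box d)
    (hp : ∀ i, 1 / 4 < p i ∧ p i < 3 / 4) :
    (fun z => periodize f (z - p)) =ᶠ[𝓝 x] fun z => f (z - p) := by
  have h := periodize_eventuallyEq hf (y := x - p) (n := 0)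
    (by simpa [latVec_zero] using norm_sub_lt_of_mem_box hx hp)
  have ht : Tendsto (fun z : Pt d => z - p) (𝓝 x) (𝓝 (x - p)) :=
    (by fun_prop : Continuous fun z : Pt d => z - p).tendsto x
  filter_upwards [ht.eventually h] with z hz
  simpa [latVec_zero] using hz

lemma exists_normalized_bump (d : ℕ) :
    ∃ ψ : Pt d → ℝ, ContDiff ℝ ((⊤ : ℕ∞)) ψ ∧ HasCompactSupport ψ ∧
      Function.support ψ ⊆ Metric.ball 0 (1 / 4) ∧ ∫ x, ψ x ^ 2 = 1 := by
  let b : ContDiffBump (0 : Pt d) := ⟨1 / 8, 1 / 4, by norm_num, by norm_num⟩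
  have hcs : HasCompactSupport fun x => b x ^ 2 :=
    b.hasCompactSupport.comp_left (g := fun t : ℝ => t ^ 2) (by simp)
  have hpos : 0 < ∫ x, b x ^ 2 := by
    refine Continuous.integral_pos_of_hasCompactSupport_nonneg_nonzero (x := 0)
      (b.continuous.pow 2) hcs (fun x => sq_nonneg _) ?_
    have : b 0 = 1 := b.one_of_mem_closedBall (by simp [b])
    simp [this]
  set I := ∫ x, b x ^ 2
  refine ⟨fun x => (√I)⁻¹ * b x, contDiff_const.mul b.contDiff,
    b.hasCompactSupport.mul_left, ?_, ?_⟩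
  · intro x hx
    have hbx : x ∈ Function.support b := right_ne_zero_of_mul hx
    rwa [b.support_eq] at hbx
  · simp only [mul_pow]
    rw [integral_const_mul, inv_pow, Real.sq_sqrt hpos.le]
    exact inv_mul_cancel₀ hpos.ne'

/-- The rescaling of `ψ` to length scale `μ⁻¹` that preserves the `L²` norm. -/
def concentrate {d : ℕ} (ψ : Pt d → ℝ) (μ : ℕ) (y : Pt d) : ℝ :=
  (μ : ℝ) ^ ((d : ℝ) / 2) * ψ ((μ : ℝ) • y)

lemma support_concentrate_subset {d : ℕ} {ψ : Pt d → ℝ}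
    (hψ : Function.support ψ ⊆ Metric.ball 0 (1 / 4)) {μ : ℕ} (hμ : 1 ≤ μ) :
    Function.support (concentrate ψ μ) ⊆ Metric.ball 0 (1 / 4 / μ) := by
  intro y hy
  have h1 : ‖(μ : ℝ) • y‖ < 1 / 4 := by simpa using hψ (right_ne_zero_of_mul hy)
  have hμ0 : (0 : ℝ) < μ := by exact_mod_cast hμ
  rw [norm_smul, Real.norm_of_nonneg hμ0.le] at h1
  rw [mem_ball_zero_iff, lt_div_iff₀ hμ0]
  linarith

lemma support_concentrate_subset_quarter {d : ℕ} {ψ : Pt d → ℝ}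
    (hψ : Function.support ψ ⊆ Metric.ball 0 (1 / 4)) {μ : ℕ} (hμ : 1 ≤ μ) :
    Function.support (concentrate ψ μ) ⊆ Metric.ball 0 (1 / 4) :=
  (support_concentrate_subset hψ hμ).trans
    (Metric.ball_subset_ball (div_le_self (by norm_num) (by exact_mod_cast hμ)))

lemma contDiff_concentrate {d : ℕ} {ψ : Pt d → ℝ} {N : ℕ∞} (hψ : ContDiff ℝ N ψ) (μ : ℕ) :
    ContDiff ℝ N (concentrate ψ μ) :=
  contDiff_const.mul (hψ.comp (contDiff_const_smul _))

lemma integral_concentrate_sq {d : ℕ} (ψ : Pt d → ℝ) {μ : ℕ} (hμ : 1 ≤ μ) :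
    ∫ y, concentrate ψ μ y ^ 2 = ∫ y, ψ y ^ 2 := by
  have hμ0 : (0 : ℝ) < μ := by exact_mod_cast hμ
  have hA : ((μ : ℝ) ^ ((d : ℝ) / 2)) ^ 2 = (μ : ℝ) ^ d := by
    rw [← Real.rpow_natCast, ← Real.rpow_mul hμ0.le, ← Real.rpow_natCast]
    congr 1
    push_cast
    ring
  simp only [concentrate, mul_pow, hA]
  rw [integral_const_mul, Measure.integral_comp_smul volume (fun y => ψ y ^ 2)]
  rw [Module.finrank_fin_fun, abs_of_pos (by positivity), smul_eq_mul, ← mul_assoc,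
    mul_inv_cancel₀ (by positivity), one_mul]

lemma iteratedFDeriv_concentrate {d : ℕ} {ψ : Pt d → ℝ} (hψ : ContDiff ℝ ((⊤ : ℕ∞)) ψ)
    (μ m : ℕ) (y : Pt d) :
    iteratedFDeriv ℝ m (concentrate ψ μ) y =
      ((μ : ℝ) ^ ((d : ℝ) / 2) * (μ : ℝ) ^ m) • iteratedFDeriv ℝ m ψ ((μ : ℝ) • y) := by
  have hm : ContDiff ℝ m ψ := hψ.of_le (by exact_mod_cast le_top)
  have h1 : concentrate ψ μ = (μ : ℝ) ^ ((d : ℝ) / 2) • fun z => ψ ((μ : ℝ) • z) := rfl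
  have hc : ContDiff ℝ m fun z => ψ ((μ : ℝ) • z) := hm.comp (contDiff_const_smul _)
  rw [h1, iteratedFDeriv_const_smul_apply hc.contDiffAt,
    iteratedFDeriv_comp_const_smul _ hm, smul_smul]

lemma setIntegral_box_periodize_sq {d : ℕ} {f : Pt d → ℝ}
    (hf : Function.support f ⊆ Metric.ball 0 (1 / 4)) {p : Pt d}
    (hp : ∀ i, 1 / 4 < p i ∧ p i < 3 / 4) :
    ∫ x in box d, periodize f (x - p) ^ 2 = ∫ y, f y ^ 2 := by
  have h1 : ∫ x in box d, periodize f (x - p) ^ 2 = ∫ x in box d, f (x - p) ^ 2 := by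
    refine setIntegral_congr_fun measurableSet_Icc fun x hx => ?_
    simp only [(periodize_sub_eventuallyEq_of_mem_box hf hx hp).eq_of_nhds]
  rw [h1, setIntegral_eq_integral_of_forall_compl_eq_zero,
    integral_sub_right_eq_self (fun y => f y ^ 2)]
  intro x hx
  have : f (x - p) = 0 := by
    by_contra h
    have hlt : ‖x - p‖ < 1 / 4 := by simpa using hf h
    have hi i : |x i - p i| < 1 / 4 := (norm_le_pi_norm (x - p) i).trans_lt hlt
    apply hx
    constructor <;> intro i <;> have := abs_lt.1 (hi i)
    · simp only [Pi.zero_apply]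
      linarith [(hp i).1]
    · simp only [Pi.one_apply]
      linarith [(hp i).2]
  simp [this]

lemma eLpNorm_iteratedFDeriv_periodize_concentrate_le {d : ℕ} {ψ : Pt d → ℝ}
    (hψ : ContDiff ℝ ((⊤ : ℕ∞)) ψ) (hs : Function.support ψ ⊆ Metric.ball 0 (1 / 4))
    {m : ℕ} {B : ℝ} (hB : ∀ y, ‖iteratedFDeriv ℝ m ψ y‖ ≤ B) (r : ℝ≥0∞) {μ : ℕ} (hμ : 1 ≤ μ)
    {p : Pt d} (hp : ∀ i, 1 / 4 < p i ∧ p i < 3 / 4) :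
    eLpNorm (fun x => iteratedFDeriv ℝ m (fun z => periodize (concentrate ψ μ) (z - p)) x) r
        (μbox d) ≤
      ENNReal.ofReal B *
        (μ : ℝ≥0∞) ^ ((m : ℝ) + (d : ℝ) / 2 - (d : ℝ) * (1 / r).toReal) := by
  have hμ0 : (0 : ℝ) < μ := by exact_mod_cast hμ
  have hB0 : 0 ≤ B := (norm_nonneg _).trans (hB 0)
  set A : ℝ := (μ : ℝ) ^ ((d : ℝ) / 2) * (μ : ℝ) ^ m with hA
  have hA0 : 0 < A := by positivity
  let S := Metric.closedBall p (1 / 4 / μ)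
  have hpt : ∀ᵐ x ∂μbox d,
      ‖iteratedFDeriv ℝ m (fun z => periodize (concentrate ψ μ) (z - p)) x‖ ≤
        ‖S.indicator (fun _ => A * B) x‖ := by
    refine ae_restrict_of_forall_mem measurableSet_Icc fun x hx => ?_
    have heq := periodize_sub_eventuallyEq_of_mem_box
      (support_concentrate_subset_quarter hs hμ) hx hp
    rw [(heq.iteratedFDeriv ℝ m).eq_of_nhds, iteratedFDeriv_comp_sub]
    by_cases hxS : x ∈ S
    · rw [Set.indicator_of_mem hxS, iteratedFDeriv_concentrate hψ, norm_smul, ← hA,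
        Real.norm_of_nonneg hA0.le, Real.norm_of_nonneg (mul_nonneg hA0.le hB0)]
      exact mul_le_mul_of_nonneg_left (hB _) hA0.le
    · have hz : iteratedFDeriv ℝ m (concentrate ψ μ) (x - p) = 0 := by
        by_contra h
        have h1 := (support_iteratedFDeriv_subset m h :
          x - p ∈ closure (Function.support (concentrate ψ μ)))
        have h2 := Metric.closure_ball_subset_closedBall
          (closure_mono (support_concentrate_subset hs hμ) h1)
        rw [mem_closedBall_zero_iff] at h2
        exact hxS (mem_closedBall_iff_norm.2 h2)
      rw [hz, norm_zero]
      exact norm_nonneg _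
  have hvol : μbox d S ≤ (μ : ℝ≥0∞) ^ (-(d : ℝ)) := by
    calc μbox d S ≤ volume S := Measure.restrict_apply_le _ _
      _ = ENNReal.ofReal ((2 * (1 / 4 / μ)) ^ d) := by
        rw [Real.volume_pi_closedBall _ (by positivity), Fintype.card_fin]
      _ ≤ ENNReal.ofReal ((μ : ℝ) ^ (-(d : ℝ))) := by
        refine ENNReal.ofReal_le_ofReal ?_
        rw [Real.rpow_neg hμ0.le, Real.rpow_natCast, ← inv_pow]
        refine pow_le_pow_left₀ (by positivity) ?_ d
        rw [div_eq_mul_inv (1 / 4 : ℝ)]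
        have : 0 < (μ : ℝ)⁻¹ := by positivity
        linarith
      _ = (μ : ℝ≥0∞) ^ (-(d : ℝ)) := by
        rw [← ENNReal.ofReal_rpow_of_pos hμ0, ENNReal.ofReal_natCast]
  have hμE0 : (μ : ℝ≥0∞) ≠ 0 := by exact_mod_cast (by omega : μ ≠ 0)
  have hμET : (μ : ℝ≥0∞) ≠ ⊤ := ENNReal.natCast_ne_top μ
  have hAe : ENNReal.ofReal A = (μ : ℝ≥0∞) ^ ((m : ℝ) + (d : ℝ) / 2) := by
    rw [hA, ← Real.rpow_natCast, ← Real.rpow_add hμ0, ← ENNReal.ofReal_rpow_of_pos hμ0,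
      ENNReal.ofReal_natCast, add_comm]
  calc _ ≤ eLpNorm (S.indicator fun _ => A * B) r (μbox d) := eLpNorm_mono_ae hpt
    _ ≤ ‖A * B‖ₑ * μbox d S ^ (1 / r.toReal) := eLpNorm_indicator_const_le _ _
    _ ≤ ‖A * B‖ₑ * ((μ : ℝ≥0∞) ^ (-(d : ℝ))) ^ (1 / r.toReal) := by gcongr
    _ = _ := by
      rw [Real.enorm_of_nonneg (by positivity), ENNReal.ofReal_mul hA0.le, hAe,
        ← ENNReal.rpow_mul, mul_comm _ (ENNReal.ofReal B), mul_assoc,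
        ← ENNReal.rpow_add _ _ hμE0 hμET, ENNReal.toReal_div, ENNReal.toReal_one]
      congr 2
      ring

lemma exists_latVec_of_periodize_ne_zero {d : ℕ} {f : Pt d → ℝ} {R : ℝ}
    (hf : Function.support f ⊆ Metric.ball 0 R) {y : Pt d} (hy : periodize f y ≠ 0) :
    ∃ n : Fin d → ℤ, ‖y - latVec n‖ < R :=
  ⟨_, mem_ball_zero_iff.1 (hf hy)⟩

/-- **Concentrated localized cutoffs** (Lemma 4.3): for `d ≥ 3` and a finite set
`K ⊂ ℤ^d` of nonzero directions there is `ρ > 0` such that for all `λ₁, μ ∈ ℕ`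
with `μ ≥ ρ⁻¹` and all `k ∈ K` there are smooth `Φ^k_{μ,λ₁}` on `T^d` with
normalized square mean, Sobolev bounds `|Φ^k_{μ,λ₁}|_{W^{i,r}} ≤ M λ₁^i μ^{i+d/2-d/r}`
(with `M` independent of `μ, λ₁`), and pairwise disjoint supports along translations
in the directions of `K`. -/
theorem concentrated_localized_cutoffs (d : ℕ) (hd : 3 ≤ d)
    (K : Finset (Fin d → ℤ)) (hK : ∀ k ∈ K, k ≠ 0) :
    ∃ ρ : ℝ, 0 < ρ ∧
    ∃ Φ : (Fin d → ℤ) → ℕ → ℕ → (Pt d → ℝ),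
      -- smoothness, periodicity and normalization
      (∀ k ∈ K, ∀ lam₁ μ : ℕ, 1 ≤ lam₁ → ρ⁻¹ ≤ (μ : ℝ) →
        ContDiff ℝ ((⊤:ℕ∞)) (Φ k μ lam₁) ∧ ZPer (Φ k μ lam₁) ∧
        (∫ x in box d, (Φ k μ lam₁ x) ^ 2) = 1) ∧
      -- Sobolev bounds, uniform in `μ` and `λ₁`
      (∀ k ∈ K, ∀ (i : ℕ) (r : ℝ≥0∞), 1 ≤ r →
        ∃ M : ℝ≥0, ∀ lam₁ μ : ℕ, 1 ≤ lam₁ → ρ⁻¹ ≤ (μ : ℝ) →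
          WNorm d i r (Φ k μ lam₁)
            ≤ M * (lam₁ : ℝ≥0∞) ^ (i : ℝ)
                * (μ : ℝ≥0∞) ^ ((i : ℝ) + (d : ℝ) / 2 - (d : ℝ) * (1 / r).toReal)) ∧
      -- disjoint supports along the direction lines
      (∀ lam₁ μ : ℕ, 1 ≤ lam₁ → ρ⁻¹ ≤ (μ : ℝ) →
        ∀ k ∈ K, ∀ k' ∈ K, k ≠ k' → ∀ s : ℝ,
          Disjoint (Function.support fun x => Φ k μ lam₁ (x - s • latVec k))
            (Function.support fun x => Φ k' μ lam₁ (x - s • latVec k'))) := by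
  obtain ⟨p, hp, hcross⟩ := exists_centers (by omega : 2 ≤ d) K
  obtain ⟨ψ, hψ, hψc, hψs, hψi⟩ := exists_normalized_bump d
  have hsep : ∀ᶠ ε in 𝓝[>] (0 : ℝ), ∀ k ∈ K, ∀ k' ∈ K, k ≠ k' →
      ∀ (s : ℝ) (m : Fin d → ℤ),
        ε ≤ ‖(p k - p k') + s • (latVec k - latVec k') + latVec m‖ := by
    refine (eventually_all_finset K).2 fun k hk => (eventually_all_finset K).2 fun k' hk' => ?_
    refine eventually_imp_distrib_left.2 fun hkk => ?_
    obtain ⟨i, j, hij⟩ := hcross k hk k' hk' hkk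
    exact eventually_le_norm_add_smul_add (k - k') (by ext; simp [latVec]) hij
  obtain ⟨ρ, hρs, hρ⟩ := (hsep.and self_mem_nhdsWithin).exists
  replace hρ : 0 < ρ := hρ
  have hμ1 {μ : ℕ} (h : ρ⁻¹ ≤ (μ : ℝ)) : 1 ≤ μ := by
    have : (0 : ℝ) < μ := (inv_pos.2 hρ).trans_le h
    exact_mod_cast this
  refine ⟨ρ, hρ, fun k μ _ x => periodize (concentrate ψ μ) (x - p k), ?_, ?_, ?_⟩
  · intro k hk _ μ _ hμ
    have hs := support_concentrate_subset_quarter hψs (hμ1 hμ)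
    refine ⟨(contDiff_periodize hs (contDiff_concentrate hψ μ)).comp
      (contDiff_id.sub contDiff_const), fun x m => ?_, ?_⟩
    · simp only [add_sub_right_comm]
      exact periodize_add_latVec _ _ m
    · rw [setIntegral_box_periodize_sq hs (hp k hk), integral_concentrate_sq ψ (hμ1 hμ), hψi]
  · intro k hk i r _
    have hB (m : ℕ) : ∃ B, ∀ y, ‖iteratedFDeriv ℝ m ψ y‖ ≤ B :=
      (hψc.iteratedFDeriv m).exists_bound_of_continuous
        (hψ.continuous_iteratedFDeriv (by exact_mod_cast le_top))
    choose B hB using hB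
    refine ⟨∑ m ∈ Finset.range (i + 1), (B m).toNNReal, fun lam₁ μ hlam hμ => ?_⟩
    have hμE : (1 : ℝ≥0∞) ≤ μ := by exact_mod_cast hμ1 hμ
    have hlE : (1 : ℝ≥0∞) ≤ (lam₁ : ℝ≥0∞) ^ (i : ℝ) := by
      rw [ENNReal.rpow_natCast]
      exact one_le_pow₀ (by exact_mod_cast hlam)
    rw [ENNReal.ofNNReal_finsetSum, Finset.sum_mul, Finset.sum_mul]
    refine Finset.sum_le_sum fun m hm => ?_
    have hmi : (m : ℝ) ≤ i := by exact_mod_cast Finset.mem_range_succ_iff.1 hm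
    refine (eLpNorm_iteratedFDeriv_periodize_concentrate_le hψ hψs (hB m) r (hμ1 hμ)
      (hp k hk)).trans ?_
    gcongr
    · exact le_mul_of_one_le_right' hlE
  · intro _ μ _ hμ k hk k' hk' hkk s
    have hμ0 : (0 : ℝ) < μ := by exact_mod_cast hμ1 hμ
    have hs := support_concentrate_subset hψs (hμ1 hμ)
    refine Set.disjoint_left.2 fun x hx hx' => ?_
    obtain ⟨n, hn⟩ := exists_latVec_of_periodize_ne_zero hs hx
    obtain ⟨n', hn'⟩ := exists_latVec_of_periodize_ne_zero hs hx'
    have h1 := hρs k hk k' hk' hkk s (n - n')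
    have h2 : (p k - p k') + s • (latVec k - latVec k') + latVec (n - n') =
        (x - s • latVec k' - p k' - latVec n') - (x - s • latVec k - p k - latVec n) := by
      ext i
      simp [latVec]
      ring
    rw [h2] at h1
    have h3 := h1.trans (norm_sub_le _ _)
    have h4 : 1 / (μ : ℝ) ≤ ρ := by
      rw [one_div]
      exact inv_le_of_inv_le₀ hρ hμ
    have h5 : 1 / 4 / (μ : ℝ) = 1 / 4 * (1 / μ) := by ring
    rw [h5] at hn hn'
    linarith

end NonNewtonian
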